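/- Cut-elimination theorem for PLK: if a sequent Γ ⇒ Δ is PLK-provable, then there is a cut-free PLK-proof of Γ ⇒ Δ. -/

import Mathlib

/-- Propositional formulas over a countably infinite set of variables. -/
inductive Fml : Type
  | var : ℕ → Fml
  | neg : Fml → Fml
  | conj : Fml → Fml → Fml
  | disj : Fml → Fml → Fml
  | imp : Fml → Fml → Fml
  deriving DecidableEq

/-- Tags for the rules of PLK; the cut tag records the cut formula. -/
inductive PLKRule : Type
  | ax | wl | wr | cl | cr | el | er
  | negL | negR | andL | andR | orL | orR | impL | impR
  | cut : Fml → PLKRule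
  deriving DecidableEq

/-- PLK-proofs of sequents (pairs of lists of formulas), where only rules
satisfying `ok` may be used.  `PLKDeriv ok Γ Δ` says the sequent Γ ⇒ Δ has a
proof tree built from axioms using rules allowed by `ok`. -/
inductive PLKDeriv (ok : PLKRule → Prop) : List Fml → List Fml → Prop
  | ax (n : ℕ) : ok .ax → PLKDeriv ok [.var n] [.var n]
  | wl (A : Fml) (Γ Δ : List Fml) : ok .wl →
      PLKDeriv ok Γ Δ → PLKDeriv ok (A :: Γ) Δ
  | wr (A : Fml) (Γ Δ : List Fml) : ok .wr →
      PLKDeriv ok Γ Δ → PLKDeriv ok Γ (Δ ++ [A])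
  | cl (A : Fml) (Γ Δ : List Fml) : ok .cl →
      PLKDeriv ok (A :: A :: Γ) Δ → PLKDeriv ok (A :: Γ) Δ
  | cr (A : Fml) (Γ Δ : List Fml) : ok .cr →
      PLKDeriv ok Γ (Δ ++ [A, A]) → PLKDeriv ok Γ (Δ ++ [A])
  | el (A B : Fml) (Γ Θ Δ : List Fml) : ok .el →
      PLKDeriv ok (Γ ++ A :: B :: Θ) Δ → PLKDeriv ok (Γ ++ B :: A :: Θ) Δ
  | er (A B : Fml) (Γ Δ Θ : List Fml) : ok .er →
      PLKDeriv ok Γ (Δ ++ A :: B :: Θ) → PLKDeriv ok Γ (Δ ++ B :: A :: Θ)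
  | negL (A : Fml) (Γ Δ : List Fml) : ok .negL →
      PLKDeriv ok Γ (Δ ++ [A]) → PLKDeriv ok (.neg A :: Γ) Δ
  | negR (A : Fml) (Γ Δ : List Fml) : ok .negR →
      PLKDeriv ok (A :: Γ) Δ → PLKDeriv ok Γ (Δ ++ [.neg A])
  | andL₁ (A B : Fml) (Γ Δ : List Fml) : ok .andL →
      PLKDeriv ok (A :: Γ) Δ → PLKDeriv ok (.conj A B :: Γ) Δ
  | andL₂ (A B : Fml) (Γ Δ : List Fml) : ok .andL →
      PLKDeriv ok (B :: Γ) Δ → PLKDeriv ok (.conj A B :: Γ) Δ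
  | andR (A B : Fml) (Γ Δ : List Fml) : ok .andR →
      PLKDeriv ok Γ (Δ ++ [A]) → PLKDeriv ok Γ (Δ ++ [B]) →
      PLKDeriv ok Γ (Δ ++ [.conj A B])
  | orL (A B : Fml) (Γ Δ : List Fml) : ok .orL →
      PLKDeriv ok (A :: Γ) Δ → PLKDeriv ok (B :: Γ) Δ →
      PLKDeriv ok (.disj A B :: Γ) Δ
  | orR₁ (A B : Fml) (Γ Δ : List Fml) : ok .orR →
      PLKDeriv ok Γ (Δ ++ [A]) → PLKDeriv ok Γ (Δ ++ [.disj A B])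
  | orR₂ (A B : Fml) (Γ Δ : List Fml) : ok .orR →
      PLKDeriv ok Γ (Δ ++ [B]) → PLKDeriv ok Γ (Δ ++ [.disj A B])
  | impL (A B : Fml) (Γ Δ : List Fml) : ok .impL →
      PLKDeriv ok Γ (Δ ++ [A]) → PLKDeriv ok (B :: Γ) Δ →
      PLKDeriv ok (.imp A B :: Γ) Δ
  | impR (A B : Fml) (Γ Δ : List Fml) : ok .impR →
      PLKDeriv ok (A :: Γ) (Δ ++ [B]) → PLKDeriv ok Γ (Δ ++ [.imp A B])
  | cut (A : Fml) (Γ Δ : List Fml) : ok (.cut A) →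
      PLKDeriv ok Γ (Δ ++ [A]) → PLKDeriv ok (A :: Γ) Δ → PLKDeriv ok Γ Δ

/-- Γ ⇒ Δ is PLK-provable (all rules allowed). -/
def PLKProvable (Γ Δ : List Fml) : Prop := PLKDeriv (fun _ => True) Γ Δ

/-- The rule `r` is not an instance of cut. -/
def noCut (r : PLKRule) : Prop := ∀ A : Fml, r ≠ PLKRule.cut A

/-- The rule `r` is not an instance of contraction (CL or CR). -/
def noContraction (r : PLKRule) : Prop := r ≠ PLKRule.cl ∧ r ≠ PLKRule.cr

/-- The rule `r` is neither contraction nor cut. -/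
def noConNoCut (r : PLKRule) : Prop := noContraction r ∧ noCut r

namespace Fml

/-- Truth of a formula under a valuation. -/
def Holds (v : ℕ → Prop) : Fml → Prop
  | var n => v n
  | neg A => ¬ A.Holds v
  | conj A B => A.Holds v ∧ B.Holds v
  | disj A B => A.Holds v ∨ B.Holds v
  | imp A B => A.Holds v → B.Holds v

/-- The number of symbols of a formula. -/
def size : Fml → ℕ
  | var _ => 1
  | neg A => A.size + 1
  | conj A B => A.size + B.size + 1
  | disj A B => A.size + B.size + 1
  | imp A B => A.size + B.size + 1

end Fml

/-- Semantic validity of the sequent Γ ⇒ Δ. -/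
def SequentValid (Γ Δ : List Fml) : Prop :=
  ∀ v : ℕ → Prop, (∀ A ∈ Γ, A.Holds v) → ∃ B ∈ Δ, B.Holds v

namespace PLKDeriv

theorem exists_holds {ok : PLKRule → Prop} {v : ℕ → Prop} {Γ Δ : List Fml}
    (h : PLKDeriv ok Γ Δ) (hΓ : ∀ A ∈ Γ, A.Holds v) : ∃ B ∈ Δ, B.Holds v := by
  induction h <;> simp [or_imp, forall_and, or_and_right, exists_or, Fml.Holds] at * <;> grind

theorem perm_left {Γ Γ' : List Fml} (p : Γ.Perm Γ') (Δ : List Fml) :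
    ∀ Θ, PLKDeriv noCut (Θ ++ Γ) Δ → PLKDeriv noCut (Θ ++ Γ') Δ := by
  induction p with
  | nil => exact fun _ h => h
  | cons A _ ih => exact fun Θ h => by simpa using ih (Θ ++ [A]) (by simpa using h)
  | swap A B Γ => exact fun Θ h => el _ _ _ _ _ (by simp [noCut]) h
  | trans _ _ ih₁ ih₂ => exact fun Θ h => ih₂ Θ (ih₁ Θ h)

theorem perm_right {Δ Δ' : List Fml} (p : Δ.Perm Δ') (Γ : List Fml) :
    ∀ Θ, PLKDeriv noCut Γ (Θ ++ Δ) → PLKDeriv noCut Γ (Θ ++ Δ') := by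
  induction p with
  | nil => exact fun _ h => h
  | cons A _ ih => exact fun Θ h => by simpa using ih (Θ ++ [A]) (by simpa using h)
  | swap A B Δ => exact fun Θ h => er _ _ _ _ _ (by simp [noCut]) h
  | trans _ _ ih₁ ih₂ => exact fun Θ h => ih₂ Θ (ih₁ Θ h)

theorem perm {Γ Γ' Δ Δ' : List Fml} (h : PLKDeriv noCut Γ Δ) (p : Γ.Perm Γ')
    (q : Δ.Perm Δ') : PLKDeriv noCut Γ' Δ' :=
  perm_right q Γ' [] (perm_left p Δ [] h)

theorem mono_left {Γ Γ' Δ : List Fml} (h : PLKDeriv noCut Γ Δ) (s : Γ ⊆ Γ') :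
    PLKDeriv noCut Γ' Δ := by
  have weaken : ∀ Θ, PLKDeriv noCut (Θ ++ Γ) Δ := fun Θ => by
    induction Θ with
    | nil => exact h
    | cons A Θ ih => exact wl _ _ _ (by simp [noCut]) ih
  have contract : ∀ Θ, Θ ⊆ Γ' → PLKDeriv noCut (Θ ++ Γ') Δ → PLKDeriv noCut Γ' Δ := fun Θ => by
    induction Θ with
    | nil => exact fun _ h => h
    | cons A Θ ih =>
      intro sΘ d
      obtain ⟨l, r, rfl⟩ := List.append_of_mem (sΘ List.mem_cons_self)
      refine ih (List.subset_of_cons_subset sΘ) ?_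
      refine (cl A (Θ ++ (l ++ r)) Δ (by simp [noCut]) (d.perm ?_ (.refl _))).perm ?_ (.refl _)
      · rw [List.perm_iff_count]; intro; simp [List.count_cons]; omega
      · rw [List.perm_iff_count]; intro; simp [List.count_cons]; omega
  exact contract Γ s ((weaken Γ').perm List.perm_append_comm (.refl _))

theorem mono_right {Γ Δ Δ' : List Fml} (h : PLKDeriv noCut Γ Δ) (s : Δ ⊆ Δ') :
    PLKDeriv noCut Γ Δ' := by
  have weaken : ∀ Θ, PLKDeriv noCut Γ (Θ ++ Δ) := fun Θ => by
    induction Θ with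
    | nil => exact h
    | cons A Θ ih =>
      exact (wr A _ _ (by simp [noCut]) ih).perm (.refl _) List.perm_append_comm
  have contract : ∀ Θ, Θ ⊆ Δ' → PLKDeriv noCut Γ (Θ ++ Δ') → PLKDeriv noCut Γ Δ' := fun Θ => by
    induction Θ with
    | nil => exact fun _ h => h
    | cons A Θ ih =>
      intro sΘ d
      obtain ⟨l, r, rfl⟩ := List.append_of_mem (sΘ List.mem_cons_self)
      refine ih (List.subset_of_cons_subset sΘ) ?_
      refine (cr A Γ (Θ ++ (l ++ r)) (by simp [noCut]) (d.perm (.refl _) ?_)).perm (.refl _) ?_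
      · rw [List.perm_iff_count]; intro; simp [List.count_cons]; omega
      · rw [List.perm_iff_count]; intro; simp [List.count_cons]
  exact contract Δ s ((weaken Δ').perm (.refl _) List.perm_append_comm)

theorem mono {Γ Γ' Δ Δ' : List Fml} (h : PLKDeriv noCut Γ Δ) (s : Γ ⊆ Γ') (t : Δ ⊆ Δ') :
    PLKDeriv noCut Γ' Δ' :=
  (h.mono_left s).mono_right t

theorem of_var_mem {n : ℕ} {Γ Δ : List Fml} (hΓ : Fml.var n ∈ Γ) (hΔ : Fml.var n ∈ Δ) :
    PLKDeriv noCut Γ Δ :=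
  (ax n (by simp [noCut])).mono (by simpa using hΓ) (by simpa using hΔ)

theorem of_sequentValid_of_vars {Γ Δ : List Fml} (hΓ : ∀ A ∈ Γ, ∃ n, A = .var n)
    (hΔ : ∀ A ∈ Δ, ∃ n, A = .var n) (h : SequentValid Γ Δ) : PLKDeriv noCut Γ Δ := by
  obtain ⟨B, hB, hv⟩ := h (fun n => Fml.var n ∈ Γ) fun A hA => by
    obtain ⟨n, rfl⟩ := hΓ A hA
    exact hA
  obtain ⟨n, rfl⟩ := hΔ B hB
  exact of_var_mem hv hB

/-- Cut-free completeness of PLK. -/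
theorem of_sequentValid (Γ Δ : List Fml) (h : SequentValid Γ Δ) : PLKDeriv noCut Γ Δ := by
  by_cases hΓ : ∀ A ∈ Γ, ∃ n, A = .var n
  · by_cases hΔ : ∀ A ∈ Δ, ∃ n, A = .var n
    · exact of_sequentValid_of_vars hΓ hΔ h
    push Not at hΔ
    obtain ⟨C, hC, hne⟩ := hΔ
    obtain ⟨l, r, rfl⟩ := List.append_of_mem hC
    suffices PLKDeriv noCut Γ ((l ++ r) ++ [C]) from this.mono_right (by grind)
    cases C with
    | var n => exact absurd rfl (hne n)
    | neg A =>
      have d := of_sequentValid (A :: Γ) (l ++ r) fun v => by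
        have hv := h v
        simp [or_imp, forall_and, or_and_right, exists_or, Fml.Holds] at hv ⊢
        grind
      exact negR _ _ _ (by simp [noCut]) d
    | conj A B =>
      have d₁ := of_sequentValid Γ ((l ++ r) ++ [A]) fun v => by
        have hv := h v
        simp [or_and_right, exists_or, Fml.Holds] at hv ⊢
        grind
      have d₂ := of_sequentValid Γ ((l ++ r) ++ [B]) fun v => by
        have hv := h v
        simp [or_and_right, exists_or, Fml.Holds] at hv ⊢
        grind
      exact andR _ _ _ _ (by simp [noCut]) d₁ d₂
    | disj A B =>
      have d := of_sequentValid Γ (((l ++ r) ++ [B]) ++ [A]) fun v => by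
        have hv := h v
        simp [or_and_right, exists_or, Fml.Holds] at hv ⊢
        grind
      have d₁ := orR₁ A B _ _ (by simp [noCut]) d
      have d₂ := orR₂ A B Γ ((l ++ r) ++ [.disj A B]) (by simp [noCut])
        (d₁.mono_right (by grind))
      exact d₂.mono_right (by grind)
    | imp A B =>
      have d := of_sequentValid (A :: Γ) ((l ++ r) ++ [B]) fun v => by
        have hv := h v
        simp [or_imp, forall_and, or_and_right, exists_or, Fml.Holds] at hv ⊢
        grind
      exact impR _ _ _ _ (by simp [noCut]) d
  · push Not at hΓ
    obtain ⟨C, hC, hne⟩ := hΓ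
    obtain ⟨l, r, rfl⟩ := List.append_of_mem hC
    suffices PLKDeriv noCut (C :: (l ++ r)) Δ from this.mono_left (by grind)
    cases C with
    | var n => exact absurd rfl (hne n)
    | neg A =>
      have d := of_sequentValid (l ++ r) (Δ ++ [A]) fun v => by
        have hv := h v
        simp [or_imp, forall_and, or_and_right, exists_or, Fml.Holds] at hv ⊢
        grind
      exact negL _ _ _ (by simp [noCut]) d
    | conj A B =>
      have d := of_sequentValid (A :: B :: (l ++ r)) Δ fun v => by
        have hv := h v
        simp [or_imp, forall_and, Fml.Holds] at hv ⊢
        grind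
      have d₁ := andL₁ A B _ _ (by simp [noCut]) d
      have d₂ := andL₂ A B (.conj A B :: (l ++ r)) Δ (by simp [noCut])
        (d₁.mono_left (by grind))
      exact d₂.mono_left (by grind)
    | disj A B =>
      have d₁ := of_sequentValid (A :: (l ++ r)) Δ fun v => by
        have hv := h v
        simp [or_imp, forall_and, or_and_right, Fml.Holds] at hv ⊢
        grind
      have d₂ := of_sequentValid (B :: (l ++ r)) Δ fun v => by
        have hv := h v
        simp [or_imp, forall_and, or_and_right, Fml.Holds] at hv ⊢
        grind
      exact orL _ _ _ _ (by simp [noCut]) d₁ d₂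
    | imp A B =>
      have d₁ := of_sequentValid (l ++ r) (Δ ++ [A]) fun v => by
        have hv := h v
        simp [or_imp, forall_and, or_and_right, exists_or, Fml.Holds] at hv ⊢
        grind
      have d₂ := of_sequentValid (B :: (l ++ r)) Δ fun v => by
        have hv := h v
        simp [or_imp, forall_and, Fml.Holds] at hv ⊢
        grind
      exact impL _ _ _ _ (by simp [noCut]) d₁ d₂
termination_by (Γ.map Fml.size).sum + (Δ.map Fml.size).sum
decreasing_by all_goals subst_vars; simp [Fml.size]; omega

end PLKDeriv

/-- cut-elimination for PLK. -/
theorem stmt_5 (Γ Δ : List Fml) (h : PLKProvable Γ Δ) :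
    PLKDeriv noCut Γ Δ :=
  .of_sequentValid Γ Δ fun _ => h.exists_holds
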